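/- arXiv:2212.08808 — 7 statements merged into one kernel-verified Lean document; each statement's English description precedes it below -/
import Mathlib

section
/- Given an influence network G(W) on node set V and any subset M ⊆ V, any two cohesive expansions of M are equal; that is, the terminal set of the node-addition process is independent of the order in which nodes are added, so Expansion(M) is well defined. -/
open Finset MeasureTheory

/-- `m` is a weighted median of `x` associated with the weights `w`. -/
def IsWMedian {V : Type*} [Fintype V] (x w : V → ℝ) (m : ℝ) : Prop :=
  (∃ i, x i = m) ∧
    (∑ i ∈ Finset.univ.filter (fun i => x i < m), w i) ≤ 1 / 2 ∧
    (∑ i ∈ Finset.univ.filter (fun i => m < x i), w i) ≤ 1 / 2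

/-- `W` is a row-stochastic matrix. -/
def RowStochastic {V : Type*} [Fintype V] (W : V → V → ℝ) : Prop :=
  (∀ i j, 0 ≤ W i j) ∧ ∀ i, ∑ j, W i j = 1

open Classical in
/-- `Med W x i` : the weighted median of `x` w.r.t. the weights of row `i` of `W`;
if it is not unique, the weighted median closest to `x i`. -/
noncomputable def Med {V : Type*} [Fintype V] (W : V → V → ℝ) (x : V → ℝ) (i : V) : ℝ :=
  if h : ∃ m, IsWMedian x (W i) m ∧ ∀ m', IsWMedian x (W i) m' → |m - x i| ≤ |m' - x i| then
    h.choose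
  else x i

/-- Trajectory of the weighted-median opinion dynamics: at step `t → t+1` the node `u t`
updates its opinion to its weighted median, all other opinions stay unchanged. -/
noncomputable def traj {V : Type*} [Fintype V] [DecidableEq V]
    (W : V → V → ℝ) (u : ℕ → V) (x0 : V → ℝ) : ℕ → V → ℝ
  | 0 => x0
  | t + 1 => Function.update (traj W u x0 t) (u t) (Med W (traj W u x0 t) (u t))

def IsEquilibrium {V : Type*} [Fintype V] (W : V → V → ℝ) (x : V → ℝ) : Prop :=
  ∀ i, Med W x i = x i

/-- `M` is a cohesive set. -/
def Cohesive {V : Type*} [Fintype V] (W : V → V → ℝ) (M : Finset V) : Prop :=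
  ∀ i ∈ M, 1 / 2 ≤ ∑ j ∈ M, W i j

/-- `M` is a maximal cohesive set. -/
def MaxCohesive {V : Type*} [Fintype V] (W : V → V → ℝ) (M : Finset V) : Prop :=
  Cohesive W M ∧ ∀ i ∉ M, ¬ (1 / 2 < ∑ j ∈ M, W i j)

/-- One step of the cohesive-expansion process: add one node `i` outside the current
set whose total weight on the current set exceeds 1/2. -/
def ExpStep {V : Type*} [Fintype V] [DecidableEq V] (W : V → V → ℝ) (A B : Finset V) : Prop :=
  ∃ i ∉ A, 1 / 2 < ∑ j ∈ A, W i j ∧ B = insert i A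

/-- `E` is a cohesive expansion of `M`: obtained from `M` by repeatedly adding nodes,
until no further node can be added. -/
def IsExpansion {V : Type*} [Fintype V] [DecidableEq V] (W : V → V → ℝ) (M E : Finset V) : Prop :=
  Relation.ReflTransGen (ExpStep W) M E ∧ ∀ i ∉ E, ¬ (1 / 2 < ∑ j ∈ E, W i j)

/-- `(i,j)` is a decisive out-link of `i`. -/
def Decisive {V : Type*} [Fintype V] [DecidableEq V] (W : V → V → ℝ) (i j : V) : Prop :=
  ∃ θ : Finset V, (∀ k ∈ θ, W i k ≠ 0) ∧ j ∈ θ ∧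
    1 / 2 < ∑ k ∈ θ, W i k ∧ (∑ k ∈ θ.erase j, W i k) < 1 / 2

/-- `μ` is the law of the i.i.d. uniform random update sequence, characterized via its
finite-dimensional cylinder probabilities. -/
def IIDUniform {n : ℕ} (μ : Measure (ℕ → Fin n)) : Prop :=
  IsProbabilityMeasure μ ∧
    ∀ (s : Finset ℕ) (g : ℕ → Fin n),
      μ {u | ∀ t ∈ s, u t = g t} = (1 / (n : ENNReal)) ^ s.card

/-- A set to which no node can be added contains every set reachable from its subsets. -/
theorem subset_of_reflTransGen_expStep {V : Type*} [Fintype V] [DecidableEq V]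
    {W : V → V → ℝ} (hW : ∀ i j, 0 ≤ W i j) {M A E : Finset V}
    (hA : Relation.ReflTransGen (ExpStep W) M A) (hME : M ⊆ E)
    (hE : ∀ i ∉ E, ¬ (1 / 2 < ∑ j ∈ E, W i j)) : A ⊆ E := by
  induction hA with
  | refl => exact hME
  | tail _ hstep ih =>
    obtain ⟨i, -, hi, rfl⟩ := hstep
    refine Finset.insert_subset (by_contra fun hiE => hE i hiE ?_) ih
    exact hi.trans_le (Finset.sum_le_sum_of_subset_of_nonneg ih fun j _ _ => hW i j)

/-- The expansion process only adds nodes. -/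
theorem subset_reachable_of_reflTransGen_expStep {V : Type*} [Fintype V] [DecidableEq V]
    {W : V → V → ℝ} {M A : Finset V}
    (hA : Relation.ReflTransGen (ExpStep W) M A) : M ⊆ A := by
  induction hA with
  | refl => exact subset_rfl
  | tail _ hstep ih =>
    obtain ⟨i, -, -, rfl⟩ := hstep
    exact ih.trans (Finset.subset_insert _ _)

/-- the cohesive expansion of any node subset `M` is unique, i.e. independent
of the order of node additions, so `Expansion(M)` is well defined. -/
theorem expansion_unique (n : ℕ) (W : Fin n → Fin n → ℝ) (hW : RowStochastic W)
    (M E₁ E₂ : Finset (Fin n))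
    (h₁ : IsExpansion W M E₁) (h₂ : IsExpansion W M E₂) :
    E₁ = E₂ := by
  exact Finset.Subset.antisymm
    (subset_of_reflTransGen_expStep hW.1 h₁.1
      (subset_reachable_of_reflTransGen_expStep h₂.1) h₂.2)
    (subset_of_reflTransGen_expStep hW.1 h₂.1
      (subset_reachable_of_reflTransGen_expStep h₁.1) h₁.2)
end

section
/- Given an influence network G(W) on node set V, if M ⊆ V is a cohesive set, then Expansion(M) is a maximal cohesive set containing M, and it is the smallest such set: for every maximal cohesive set M̂ with M ⊆ M̂, one has Expansion(M) ⊆ M̂. -/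
open Finset MeasureTheory

theorem sum_weight_mono {V : Type*} [Fintype V] {W : V → V → ℝ}
    (hW : ∀ i j, 0 ≤ W i j) {A B : Finset V} (h : A ⊆ B) (i : V) :
    ∑ j ∈ A, W i j ≤ ∑ j ∈ B, W i j :=
  Finset.sum_le_sum_of_subset_of_nonneg h fun j _ _ => hW i j

theorem ExpStep.subset {V : Type*} [Fintype V] [DecidableEq V] {W : V → V → ℝ}
    {A B : Finset V} (h : ExpStep W A B) : A ⊆ B := by
  obtain ⟨i, -, -, rfl⟩ := h
  exact Finset.subset_insert i A

theorem ExpStep.cohesive {V : Type*} [Fintype V] [DecidableEq V] {W : V → V → ℝ}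
    (hW : ∀ i j, 0 ≤ W i j) {A B : Finset V} (h : ExpStep W A B) (hA : Cohesive W A) :
    Cohesive W B := by
  obtain ⟨i, -, hi, rfl⟩ := h
  intro k hk
  refine le_trans ?_ (sum_weight_mono hW (Finset.subset_insert i A) k)
  rcases Finset.mem_insert.mp hk with rfl | hk
  · exact hi.le
  · exact hA k hk

theorem ExpStep.subset_of_maxCohesive {V : Type*} [Fintype V] [DecidableEq V]
    {W : V → V → ℝ} (hW : ∀ i j, 0 ≤ W i j) {A B C : Finset V} (h : ExpStep W A B)
    (hC : MaxCohesive W C) (hAC : A ⊆ C) : B ⊆ C := by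
  obtain ⟨i, -, hi, rfl⟩ := h
  refine Finset.insert_subset ?_ hAC
  by_contra hiC
  exact hC.2 i hiC (hi.trans_le (sum_weight_mono hW hAC i))

/-- The expansion process terminates, since each step strictly enlarges the current set. -/
theorem exists_isExpansion {V : Type*} [Fintype V] [DecidableEq V] (W : V → V → ℝ)
    (M : Finset V) : ∃ E, IsExpansion W M E := by
  induction M using WellFoundedGT.induction with
  | ind M ih =>
    by_cases h : ∀ i ∉ M, ¬ (1 / 2 < ∑ j ∈ M, W i j)
    · exact ⟨M, .refl, h⟩
    · push Not at h
      obtain ⟨i, hiM, hi⟩ := h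
      obtain ⟨E, hE, hmax⟩ := ih (insert i M) (Finset.ssubset_insert hiM)
      exact ⟨E, .head ⟨i, hiM, hi, rfl⟩ hE, hmax⟩

/-- if `M` is cohesive then its cohesive expansion exists, contains `M`, is a
maximal cohesive set, and is the smallest maximal cohesive set containing `M`. -/
theorem expansion_of_cohesive_is_smallest_max_cohesive (n : ℕ)
    (W : Fin n → Fin n → ℝ) (hW : RowStochastic W)
    (M : Finset (Fin n)) (hM : Cohesive W M) :
    (∃ E, IsExpansion W M E) ∧
    ∀ E, IsExpansion W M E →
      M ⊆ E ∧ MaxCohesive W E ∧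
        ∀ M' : Finset (Fin n), MaxCohesive W M' → M ⊆ M' → E ⊆ M' := by
  refine ⟨exists_isExpansion W M, ?_⟩
  rintro E ⟨hE, hmax⟩
  refine ⟨?_, ⟨?_, hmax⟩, fun M' hM' hMM' => ?_⟩
  · clear hmax
    induction hE with
    | refl => exact Finset.Subset.refl M
    | tail _ hstep ih => exact ih.trans hstep.subset
  · clear hmax
    induction hE with
    | refl => exact hM
    | tail _ hstep ih => exact hstep.cohesive hW.1 ih
  · clear hmax
    induction hE with
    | refl => exact hMM'
    | tail _ hstep ih => exact hstep.subset_of_maxCohesive hW.1 hM' ih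
end

section
/- Given an influence network G(W) on node set V and a cohesive set M ⊆ V: if M is maximally cohesive, then V∖M is also maximally cohesive; if M is not maximally cohesive, then either Expansion(M) = V, or Expansion(M) and V∖Expansion(M) are both nonempty and maximally cohesive. -/
open Finset MeasureTheory

section CohesiveSets

variable {V : Type*} [Fintype V] [DecidableEq V] {W : V → V → ℝ} {M E : Finset V}

/-- The complement of a maximally cohesive set is maximally cohesive. -/
lemma MaxCohesive.univ_sdiff (hW : RowStochastic W) (hM : MaxCohesive W M) :
    MaxCohesive W (Finset.univ \ M) := by
  have row_split : ∀ i, ∑ j ∈ Finset.univ \ M, W i j + ∑ j ∈ M, W i j = 1 := fun i => by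
    rw [Finset.sum_sdiff (Finset.subset_univ M), hW.2 i]
  refine ⟨fun i hi => ?_, fun i hi => ?_⟩
  · have := hM.2 i (Finset.mem_sdiff.mp hi).2
    linarith [row_split i]
  · have := hM.1 i (by simpa using hi)
    linarith [row_split i]

/-- Adding a node by an expansion step preserves cohesiveness. -/
lemma Cohesive.of_expStep (hW : RowStochastic W) (hM : Cohesive W M) (h : ExpStep W M E) :
    Cohesive W E := by
  obtain ⟨i, -, hi, rfl⟩ := h
  intro k hk
  have hmono : ∑ j ∈ M, W k j ≤ ∑ j ∈ insert i M, W k j :=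
    Finset.sum_le_sum_of_subset_of_nonneg (Finset.subset_insert i M) fun j _ _ => hW.1 k j
  rcases Finset.mem_insert.mp hk with rfl | hk
  · exact hi.le.trans hmono
  · exact (hM k hk).trans hmono

/-- A cohesive expansion of a cohesive set is maximally cohesive. -/
lemma IsExpansion.maxCohesive (hW : RowStochastic W) (hM : Cohesive W M)
    (h : IsExpansion W M E) : MaxCohesive W E := by
  refine ⟨?_, h.2⟩
  have hsteps := h.1
  clear h
  induction hsteps with
  | refl => exact hM
  | tail _ hstep ih => exact ih.of_expStep hW hstep

/-- An expansion that is empty is reached without any step. -/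
lemma IsExpansion.eq_empty (h : IsExpansion W M ∅) : M = ∅ := by
  rcases h.1.cases_tail with h | ⟨A, -, i, -, -, hA⟩
  · exact h.symm
  · exact absurd hA.symm (Finset.insert_ne_empty i A)

end CohesiveSets

/-- cohesive partition: for a cohesive set `M`: if `M` is maximally cohesive
then so is `V ∖ M`; if `M` is not maximally cohesive, then either `Expansion(M) = V`, or
`Expansion(M)` and `V ∖ Expansion(M)` are both nonempty and maximally cohesive. -/
theorem cohesive_partition (n : ℕ) (W : Fin n → Fin n → ℝ) (hW : RowStochastic W)
    (M : Finset (Fin n)) (hM : Cohesive W M) :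
    (MaxCohesive W M → MaxCohesive W (Finset.univ \ M)) ∧
    (¬ MaxCohesive W M →
      ∀ E, IsExpansion W M E →
        E = Finset.univ ∨
          (E.Nonempty ∧ MaxCohesive W E ∧
            (Finset.univ \ E).Nonempty ∧ MaxCohesive W (Finset.univ \ E))) := by
  refine ⟨fun h => h.univ_sdiff hW, fun hnot E hE => ?_⟩
  have hmax : MaxCohesive W E := hE.maxCohesive hW hM
  refine or_iff_not_imp_left.mpr fun hne => ⟨?_, hmax, ?_, hmax.univ_sdiff hW⟩
  · rw [Finset.nonempty_iff_ne_empty]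
    rintro rfl
    exact hnot (hE.eq_empty ▸ hmax)
  · rw [Finset.sdiff_nonempty, Finset.univ_subset_iff]
    exact hne
end

section
/- Given an influence network G(W) on node set V with n individuals, a vector x* ∈ ℝ^n is an equilibrium of the weighted-median opinion dynamics if and only if either x* is a consensus vector (x*_i = x*_j for all i, j ∈ V), or for every real y with min_i x*_i < y ≤ max_i x*_i, both sets {i ∈ V : x*_i < y} and {i ∈ V : x*_i ≥ y} are maximally cohesive sets of G(W). -/
open Finset MeasureTheory

section WeightedMedian

variable {V : Type*} [Fintype V]

/-- If some value of `x` exceeds `m`, the next larger value `x k` satisfies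
`x k ≤ x j ↔ m < x j`. -/
theorem exists_next_value (x : V → ℝ) {m : ℝ} (h : ∃ j, m < x j) :
    ∃ k, ∀ j, x k ≤ x j ↔ m < x j := by
  obtain ⟨k, hk, hmin⟩ := (Finset.univ.filter (fun j => m < x j)).exists_min_image x
    (by obtain ⟨j, hj⟩ := h; exact ⟨j, by simpa using hj⟩)
  simp only [Finset.mem_filter, Finset.mem_univ, true_and] at hk hmin
  exact ⟨k, fun j => ⟨fun hj => hk.trans_le hj, hmin j⟩⟩

theorem sum_lt_add_sum_le (x w : V → ℝ) (y : ℝ) :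
    (∑ j ∈ Finset.univ.filter (fun j => x j < y), w j) +
      ∑ j ∈ Finset.univ.filter (fun j => y ≤ x j), w j = ∑ j, w j := by
  simpa only [not_lt] using
    Finset.sum_filter_add_sum_filter_not Finset.univ (fun j => x j < y) w

theorem exists_isWMedian [Nonempty V] (x w : V → ℝ) (hsum : ∑ j, w j = 1) :
    ∃ m, IsWMedian x w m := by
  obtain ⟨k₀, -, hk₀⟩ := Finset.univ.exists_min_image x Finset.univ_nonempty
  obtain ⟨k, hk, hmax⟩ := (Finset.univ.filter (fun k =>
      ∑ j ∈ Finset.univ.filter (fun j => x j < x k), w j ≤ 1 / 2)).exists_max_image x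
    ⟨k₀, by
      have : Finset.univ.filter (fun j => x j < x k₀) = ∅ :=
        Finset.filter_eq_empty_iff.2 fun j hj => not_lt.2 (hk₀ j hj)
      simp [this]⟩
  simp only [Finset.mem_filter, Finset.mem_univ, true_and] at hk hmax
  refine ⟨x k, ⟨k, rfl⟩, hk, ?_⟩
  by_cases h : ∃ j, x k < x j
  · obtain ⟨l, hl⟩ := exists_next_value x h
    by_contra! hgt
    have hsplit := sum_lt_add_sum_le x w (x l)
    simp only [hl] at hsplit
    have := hmax l (by linarith)
    exact this.not_gt ((hl l).1 le_rfl)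
  · push Not at h
    have : Finset.univ.filter (fun j => x k < x j) = ∅ :=
      Finset.filter_eq_empty_iff.2 fun j _ => not_lt.2 (h j)
    simp [this]

theorem exists_closest_isWMedian [Nonempty V] (x w : V → ℝ) (hsum : ∑ j, w j = 1) (c : ℝ) :
    ∃ m, IsWMedian x w m ∧ ∀ m', IsWMedian x w m' → |m - c| ≤ |m' - c| := by
  have hfin : {m | IsWMedian x w m}.Finite :=
    (Set.finite_range x).subset fun m hm => hm.1
  exact Set.exists_min_image _ (fun m => |m - c|) hfin (exists_isWMedian x w hsum)

theorem med_eq_self_iff {W : V → V → ℝ} (hW : RowStochastic W) (x : V → ℝ) (i : V) :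
    Med W x i = x i ↔ IsWMedian x (W i) (x i) := by
  have : Nonempty V := ⟨i⟩
  have h := exists_closest_isWMedian x (W i) (hW.2 i) (x i)
  rw [Med, dif_pos h]
  constructor
  · intro heq
    simpa only [heq] using h.choose_spec.1
  · intro hmed
    have hle := h.choose_spec.2 _ hmed
    rw [sub_self, abs_zero] at hle
    exact sub_eq_zero.1 (abs_nonpos_iff.1 hle)

theorem isEquilibrium_iff {W : V → V → ℝ} (hW : RowStochastic W) (x : V → ℝ) :
    IsEquilibrium W x ↔ ∀ i,
      (∑ j ∈ Finset.univ.filter (fun j => x j < x i), W i j) ≤ 1 / 2 ∧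
      (∑ j ∈ Finset.univ.filter (fun j => x i < x j), W i j) ≤ 1 / 2 :=
  forall_congr' fun i => (med_eq_self_iff hW x i).trans (and_iff_right ⟨i, rfl⟩)

theorem IsEquilibrium.maxCohesive {W : V → V → ℝ} (hW : RowStochastic W) {x : V → ℝ}
    (hx : IsEquilibrium W x) (y : ℝ) :
    MaxCohesive W (Finset.univ.filter (fun i => x i < y)) ∧
      MaxCohesive W (Finset.univ.filter (fun i => y ≤ x i)) := by
  rw [isEquilibrium_iff hW] at hx
  have hlow : ∀ i, y ≤ x i →
      ∑ j ∈ Finset.univ.filter (fun j => x j < y), W i j ≤ 1 / 2 := fun i hi =>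
    (Finset.sum_le_sum_of_subset_of_nonneg
      (Finset.monotone_filter_right _ fun _ _ hj => lt_of_lt_of_le hj hi)
      fun j _ _ => hW.1 i j).trans (hx i).1
  have hhigh : ∀ i, x i < y →
      ∑ j ∈ Finset.univ.filter (fun j => y ≤ x j), W i j ≤ 1 / 2 := fun i hi =>
    (Finset.sum_le_sum_of_subset_of_nonneg
      (Finset.monotone_filter_right _ fun _ _ hj => lt_of_lt_of_le hi hj)
      fun j _ _ => hW.1 i j).trans (hx i).2
  have hsplit i := (sum_lt_add_sum_le x (W i) y).trans (hW.2 i)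
  refine ⟨⟨fun i hi => ?_, fun i hi => ?_⟩, fun i hi => ?_, fun i hi => ?_⟩ <;>
    simp only [Finset.mem_filter, Finset.mem_univ, true_and, not_lt, not_le] at hi ⊢
  · linarith [hsplit i, hhigh i hi]
  · exact hlow i hi
  · linarith [hsplit i, hlow i hi]
  · exact hhigh i hi

theorem isEquilibrium_of_consensus {W : V → V → ℝ} (hW : RowStochastic W) {x : V → ℝ}
    (hx : ∀ i j, x i = x j) : IsEquilibrium W x := by
  rw [isEquilibrium_iff hW]
  intro i
  simp [hx _ i]

theorem isEquilibrium_of_maxCohesive {W : V → V → ℝ} (hW : RowStochastic W) {x : V → ℝ}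
    (hx : ∀ y : ℝ, (∃ i, x i < y) → (∃ i, y ≤ x i) →
      MaxCohesive W (Finset.univ.filter (fun i => x i < y)) ∧
      MaxCohesive W (Finset.univ.filter (fun i => y ≤ x i))) :
    IsEquilibrium W x := by
  rw [isEquilibrium_iff hW]
  refine fun i => ⟨?_, ?_⟩
  · by_cases h : ∃ j, x j < x i
    · exact not_lt.1 ((hx (x i) h ⟨i, le_rfl⟩).1.2 i (by simp))
    · simp [not_exists.1 h]
  · by_cases h : ∃ j, x i < x j
    · obtain ⟨k, hk⟩ := exists_next_value x h
      have hmax := (hx (x k) ⟨i, (hk k).1 le_rfl⟩ ⟨k, le_rfl⟩).2.2 i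
      simp only [hk] at hmax
      exact not_lt.1 (hmax (by simp))
    · simp [not_exists.1 h]

end WeightedMedian

/-- set of equilibria: `x*` is an equilibrium of the weighted-median opinion
dynamics iff it is a consensus vector, or for every `y` with `min_i x*_i < y ≤ max_i x*_i`
both `{i : x*_i < y}` and `{i : x*_i ≥ y}` are maximal cohesive sets. -/
theorem equilibrium_characterization (n : ℕ) (W : Fin n → Fin n → ℝ)
    (hW : RowStochastic W) (x : Fin n → ℝ) :
    IsEquilibrium W x ↔
      ((∀ i j, x i = x j) ∨
        ∀ y : ℝ, (∃ i, x i < y) → (∃ i, y ≤ x i) →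
          MaxCohesive W (Finset.univ.filter (fun i => x i < y)) ∧
          MaxCohesive W (Finset.univ.filter (fun i => y ≤ x i))) := by
  constructor
  · exact fun hx => Or.inr fun y _ _ => hx.maxCohesive hW y
  · rintro (hx | hx)
    · exact isEquilibrium_of_consensus hW hx
    · exact isEquilibrium_of_maxCohesive hW hx
end

section
/- Given an influence network G(W) on node set V, let x, x̃ ∈ ℝ^n be order-isomorphic, i.e., for all i, j ∈ V: x_i < x_j if and only if x̃_i < x̃_j. Then for every i ∈ V and every j ∈ V, Med_i(x;W) = x_j implies Med_i(x̃;W) = x̃_j. Consequently, for any update sequence, the trajectories of the weighted-median opinion dynamics started from x and from x̃ remain order-isomorphic at every time step; in particular one reaches a consensus vector at time T if and only if the other does. -/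
open Finset MeasureTheory

/-- A value between two weighted medians that is attained by `x` is a weighted median. -/
theorem IsWMedian.of_between {V : Type*} [Fintype V] {x w : V → ℝ} (hw : ∀ j, 0 ≤ w j)
    {a b : ℝ} {i : V} (ha : IsWMedian x w a) (hb : IsWMedian x w b)
    (hai : a ≤ x i) (hib : x i ≤ b) : IsWMedian x w (x i) := by
  refine ⟨⟨i, rfl⟩, le_trans ?_ hb.2.1, le_trans ?_ ha.2.2⟩
  · refine Finset.sum_le_sum_of_subset_of_nonneg (fun k hk => ?_) fun k _ _ => hw k
    simp only [Finset.mem_filter_univ] at hk ⊢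
    exact hk.trans_le hib
  · refine Finset.sum_le_sum_of_subset_of_nonneg (fun k hk => ?_) fun k _ _ => hw k
    simp only [Finset.mem_filter_univ] at hk ⊢
    exact hai.trans_lt hk

/-- `m` is a weighted median of `x` whose distance to `x i` is minimal. -/
def IsClosestWMedian {V : Type*} [Fintype V] (x w : V → ℝ) (i : V) (m : ℝ) : Prop :=
  IsWMedian x w m ∧ ∀ m', IsWMedian x w m' → |m - x i| ≤ |m' - x i|

/-- Being the closest weighted median depends only on the order of the entries of `x`. -/
theorem isClosestWMedian_iff {V : Type*} [Fintype V] {x w : V → ℝ} (hw : ∀ j, 0 ≤ w j)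
    (i j : V) : IsClosestWMedian x w i (x j) ↔ IsWMedian x w (x j) ∧
      ∀ k, IsWMedian x w (x k) → (x i < x j → ¬ x k < x j) ∧ (x j < x i → ¬ x j < x k) := by
  constructor
  · rintro ⟨hj, hmin⟩
    refine ⟨hj, fun k hk => ⟨fun hij hkj => ?_, fun hji hjk => ?_⟩⟩
    · rcases le_total (x k) (x i) with hki | hik
      · have h := hmin _ (hk.of_between hw hj hki hij.le)
        rw [sub_self, abs_zero, abs_of_pos (sub_pos.2 hij)] at h
        linarith
      · have h := hmin _ hk
        rw [abs_of_pos (sub_pos.2 hij), abs_of_nonneg (sub_nonneg.2 hik)] at h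
        linarith
    · rcases le_total (x i) (x k) with hik | hki
      · have h := hmin _ (hj.of_between hw hk hji.le hik)
        rw [sub_self, abs_zero, abs_of_neg (sub_neg.2 hji)] at h
        linarith
      · have h := hmin _ hk
        rw [abs_of_neg (sub_neg.2 hji), abs_of_nonpos (sub_nonpos.2 hki)] at h
        linarith
  · rintro ⟨hj, hmin⟩
    refine ⟨hj, fun m hm => ?_⟩
    obtain ⟨k, rfl⟩ := hm.1
    rcases lt_trichotomy (x i) (x j) with hij | hij | hji
    · rw [abs_of_pos (sub_pos.2 hij)]
      have := (hmin k hm).1 hij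
      exact le_trans (by linarith) (le_abs_self _)
    · simp [hij]
    · rw [abs_of_neg (sub_neg.2 hji)]
      have := (hmin k hm).2 hji
      exact le_trans (by linarith) (neg_le_abs _)

/-- The closest weighted median is unique. -/
theorem IsClosestWMedian.unique {V : Type*} [Fintype V] {x w : V → ℝ} (hw : ∀ j, 0 ≤ w j)
    {i : V} {a b : ℝ} (ha : IsClosestWMedian x w i a) (hb : IsClosestWMedian x w i b) :
    a = b := by
  obtain ⟨j, rfl⟩ := ha.1.1
  obtain ⟨k, rfl⟩ := hb.1.1
  rw [isClosestWMedian_iff hw] at ha hb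
  have hjk := ha.2 k hb.1
  have hkj := hb.2 j ha.1
  grind

theorem isWMedian_iff_of_order_iso {V : Type*} [Fintype V] {x x' : V → ℝ}
    (hiso : ∀ i j, x i < x j ↔ x' i < x' j) (w : V → ℝ) (j : V) :
    IsWMedian x w (x j) ↔ IsWMedian x' w (x' j) := by
  have hx : ∃ i, x i = x j := ⟨j, rfl⟩
  have hx' : ∃ i, x' i = x' j := ⟨j, rfl⟩
  simp only [IsWMedian, hiso, hx, hx']

theorem isClosestWMedian_iff_of_order_iso {V : Type*} [Fintype V] {x x' w : V → ℝ}
    (hw : ∀ j, 0 ≤ w j) (hiso : ∀ i j, x i < x j ↔ x' i < x' j) (i j : V) :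
    IsClosestWMedian x w i (x j) ↔ IsClosestWMedian x' w i (x' j) := by
  simp only [isClosestWMedian_iff hw, isWMedian_iff_of_order_iso hiso, hiso]

theorem Med_eq_of_isClosestWMedian {V : Type*} [Fintype V] {W : V → V → ℝ} {x : V → ℝ} {i : V}
    (hw : ∀ j, 0 ≤ W i j) {m : ℝ} (hm : IsClosestWMedian x (W i) i m) : Med W x i = m := by
  have h : ∃ m, IsClosestWMedian x (W i) i m := ⟨m, hm⟩
  have hMed : Med W x i = h.choose := dif_pos h
  exact hMed.trans (IsClosestWMedian.unique hw h.choose_spec hm)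

theorem Med_eq_self_of_not_exists {V : Type*} [Fintype V] {W : V → V → ℝ} {x : V → ℝ} {i : V}
    (h : ¬ ∃ m, IsClosestWMedian x (W i) i m) : Med W x i = x i :=
  dif_neg h

/-- Order-isomorphic vectors take their weighted medians at a common index. -/
theorem exists_Med_eq_of_order_iso {V : Type*} [Fintype V] {W : V → V → ℝ} {x x' : V → ℝ} {i : V}
    (hw : ∀ j, 0 ≤ W i j) (hiso : ∀ i j, x i < x j ↔ x' i < x' j) :
    ∃ k, Med W x i = x k ∧ Med W x' i = x' k := by
  by_cases h : ∃ k, IsClosestWMedian x (W i) i (x k)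
  · obtain ⟨k, hk⟩ := h
    exact ⟨k, Med_eq_of_isClosestWMedian hw hk, Med_eq_of_isClosestWMedian hw
      ((isClosestWMedian_iff_of_order_iso hw hiso i k).1 hk)⟩
  · refine ⟨i, Med_eq_self_of_not_exists ?_, Med_eq_self_of_not_exists ?_⟩
    · rintro ⟨m, hm⟩
      obtain ⟨k, rfl⟩ := hm.1.1
      exact h ⟨k, hm⟩
    · rintro ⟨m, hm⟩
      obtain ⟨k, rfl⟩ := hm.1.1
      exact h ⟨k, (isClosestWMedian_iff_of_order_iso hw hiso i k).2 hm⟩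

theorem eq_iff_eq_of_order_iso {V : Type*} {x x' : V → ℝ}
    (hiso : ∀ i j, x i < x j ↔ x' i < x' j) (i j : V) : x i = x j ↔ x' i = x' j := by
  simp only [le_antisymm_iff, ← not_lt, hiso]

/-- Order isomorphism is preserved along the weighted-median dynamics. -/
theorem traj_order_iso {V : Type*} [Fintype V] [DecidableEq V] {W : V → V → ℝ}
    (hW : ∀ i j, 0 ≤ W i j) {x x' : V → ℝ} (hiso : ∀ i j, x i < x j ↔ x' i < x' j)
    (u : ℕ → V) (t : ℕ) (i j : V) :
    traj W u x t i < traj W u x t j ↔ traj W u x' t i < traj W u x' t j := by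
  induction t generalizing i j with
  | zero => exact hiso i j
  | succ t ih =>
    obtain ⟨k, hk, hk'⟩ := exists_Med_eq_of_order_iso (hW (u t)) ih
    simp only [traj, Function.update_apply, hk, hk']
    split_ifs <;> simp [ih]

/-- if `x` and `x'` are order-isomorphic, then weighted medians are taken at
the same indices, trajectories from `x` and `x'` under any update sequence remain
order-isomorphic at every time, and one reaches consensus at time `T` iff the other does. -/
theorem order_isomorphic_trajectories (n : ℕ) (hn : 0 < n)
    (W : Fin n → Fin n → ℝ) (hW : RowStochastic W)
    (x x' : Fin n → ℝ) (hiso : ∀ i j, x i < x j ↔ x' i < x' j) :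
    (∀ i j, Med W x i = x j → Med W x' i = x' j) ∧
    ∀ u : ℕ → Fin n,
      (∀ t i j, traj W u x t i < traj W u x t j ↔ traj W u x' t i < traj W u x' t j) ∧
      (∀ T, (∀ i j, traj W u x T i = traj W u x T j) ↔
        (∀ i j, traj W u x' T i = traj W u x' T j)) := by
  refine ⟨fun i j hij => ?_, fun u => ⟨traj_order_iso hW.1 hiso u, fun T => ?_⟩⟩
  · obtain ⟨k, hk, hk'⟩ := exists_Med_eq_of_order_iso (hW.1 i) hiso
    rw [hk', ← eq_iff_eq_of_order_iso hiso, ← hk, hij]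
  · exact forall₂_congr (eq_iff_eq_of_order_iso (traj_order_iso hW.1 hiso u T))
end

section
/- Given an influence network G(W) on node set V, suppose that from every state x ∈ ℝ^n there exist T_x ∈ ℕ and a finite update sequence i_1, …, i_{T_x} along which the trajectory of the weighted-median opinion dynamics started at x reaches an equilibrium at time T_x. Then for every initial state x(0) ∈ ℝ^n, with respect to the i.i.d. uniform random update sequence, almost surely there exists a finite time T such that x(T) is an equilibrium (and x(t) = x(T) for all t ≥ T). -/
open Finset MeasureTheory

theorem Med_mem_range {V : Type*} [Fintype V] {W : V → V → ℝ} (x : V → ℝ) (i : V) :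
    Med W x i ∈ Set.range x := by
  unfold Med
  split_ifs with h
  · exact h.choose_spec.1.1
  · exact ⟨i, rfl⟩

section Trajectories

variable {V : Type*} [Fintype V] [DecidableEq V] {W : V → V → ℝ}

theorem traj_add (u : ℕ → V) (x : V → ℝ) (s t : ℕ) :
    traj W u x (s + t) = traj W (fun k => u (s + k)) (traj W u x s) t := by
  induction t with
  | zero => rfl
  | succ t ih => rw [← Nat.add_assoc, traj, traj, ih]

theorem traj_congr {u v : ℕ → V} (x : V → ℝ) {T : ℕ} (h : ∀ t < T, u t = v t) :
    traj W u x T = traj W v x T := by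
  induction T with
  | zero => rfl
  | succ T ih =>
    rw [traj, traj, ih fun t ht => h t (Nat.lt_succ_of_lt ht), h T (Nat.lt_succ_self T)]

theorem IsEquilibrium.traj_eq {x : V → ℝ} (hx : IsEquilibrium W x) (u : ℕ → V) (t : ℕ) :
    traj W u x t = x := by
  induction t with
  | zero => rfl
  | succ t ih => rw [traj, ih, hx, Function.update_eq_self]

theorem traj_mem_range (u : ℕ → V) (x : V → ℝ) (t : ℕ) (i : V) :
    traj W u x t i ∈ Set.range x := by
  induction t generalizing i with
  | zero => exact ⟨i, rfl⟩
  | succ t ih =>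
    rw [traj, Function.update_apply]
    split_ifs
    · obtain ⟨j, hj⟩ := Med_mem_range (W := W) (traj W u x t) (u t)
      exact hj ▸ ih j
    · exact ih i

/-- If every state can be driven to an equilibrium, then a single finite update sequence drives
all states of a finite set to equilibria. -/
theorem exists_uniform_update_sequence [Nonempty V]
    (H : ∀ x : V → ℝ, ∃ (T : ℕ) (u : ℕ → V), IsEquilibrium W (traj W u x T))
    {S : Set (V → ℝ)} (hS : S.Finite) :
    ∃ (T : ℕ) (u : ℕ → V), ∀ x ∈ S, IsEquilibrium W (traj W u x T) := by
  induction S, hS using Set.Finite.induction_on with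
  | empty => exact ⟨0, fun _ => Classical.arbitrary V, by simp⟩
  | @insert x S _ _ ih =>
    obtain ⟨T, u, hu⟩ := ih
    obtain ⟨T', u', hu'⟩ := H (traj W u x T)
    let v : ℕ → V := fun t => if t < T then u t else u' (t - T)
    have hv (y : V → ℝ) : traj W v y (T + T') = traj W u' (traj W u y T) T' := by
      have hpre : traj W v y T = traj W u y T := traj_congr y fun t ht => by simp [v, ht]
      have hpost : (fun k => v (T + k)) = u' := by
        funext k
        simp [v]
      rw [traj_add, hpre, hpost]
    refine ⟨T + T', v, fun y hy => ?_⟩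
    rw [hv]
    rcases hy with rfl | hy
    · exact hu'
    · rw [(hu y hy).traj_eq]
      exact hu y hy

end Trajectories

/-- Under the i.i.d. uniform law, every finite word almost surely appears in infinitely many of
the consecutive blocks of its length. -/
theorem IIDUniform.measure_limsup_block_eq_one {n : ℕ} {μ : Measure (ℕ → Fin n)}
    (hμ : IIDUniform μ) (T : ℕ) (v : ℕ → Fin n) :
    μ (Filter.limsup (fun k => {u : ℕ → Fin n | ∀ j < T, u (k * T + j) = v j})
      Filter.atTop) = 1 := by
  have := hμ.1
  let B : ℕ → Finset ℕ := fun k => Finset.Ico (k * T) (k * T + T)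
  have hB (k : ℕ) : {u : ℕ → Fin n | ∀ j < T, u (k * T + j) = v j} =
      {u | ∀ t ∈ B k, u t = v (t % T)} := by
    ext u
    simp only [Set.mem_ofPred_eq, B, Finset.mem_Ico]
    constructor
    · rintro h t ⟨h₁, h₂⟩
      obtain ⟨j, rfl⟩ := Nat.exists_eq_add_of_le h₁
      have hj : j < T := by omega
      rw [h j hj, Nat.mul_add_mod_self_right, Nat.mod_eq_of_lt hj]
    · intro h j hj
      rw [h _ ⟨by omega, by omega⟩, Nat.mul_add_mod_self_right, Nat.mod_eq_of_lt hj]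
  have hdisj : Pairwise (Function.onFun Disjoint B) := by
    intro k l hkl
    rw [Function.onFun, Finset.disjoint_left]
    intro t hk hl
    simp only [B, Finset.mem_Ico] at hk hl
    rcases lt_or_gt_of_ne hkl with h | h <;> nlinarith
  have hcard (k : ℕ) : (B k).card = T := by simp [B]
  have hmeas (k : ℕ) : MeasurableSet {u : ℕ → Fin n | ∀ j < T, u (k * T + j) = v j} := by
    measurability
  have hprob (k : ℕ) : μ {u : ℕ → Fin n | ∀ j < T, u (k * T + j) = v j} =
      (1 / (n : ENNReal)) ^ T := by
    rw [hB, hμ.2 (B k) fun t => v (t % T), hcard]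
  refine ProbabilityTheory.measure_limsup_eq_one hmeas ?_ ?_
  · rw [ProbabilityTheory.iIndepSet_iff_meas_biInter hmeas]
    intro s
    have hinter : ⋂ k ∈ s, {u : ℕ → Fin n | ∀ j < T, u (k * T + j) = v j} =
        {u | ∀ t ∈ s.biUnion B, u t = v (t % T)} := by
      ext u
      simp only [hB, Set.mem_iInter, Set.mem_ofPred_eq, Finset.mem_biUnion]
      grind
    rw [hinter, hμ.2 _ fun t => v (t % T),
      Finset.card_biUnion fun k _ l _ hkl => hdisj hkl]
    simp only [hprob, hcard, Finset.prod_pow_eq_pow_sum]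
  · simp only [hprob]
    exact ENNReal.tsum_const_eq_top_of_ne_zero (by simp)

/-- transforming randomness to sequence design: if from every state some
finite update sequence reaches an equilibrium, then for every initial state, under the
i.i.d. uniform random update sequence, almost surely the dynamics reach an equilibrium in
finite time (and stay there). -/
theorem randomness_to_sequence_design (n : ℕ) (hn : 0 < n)
    (W : Fin n → Fin n → ℝ) (hW : RowStochastic W)
    (H : ∀ x : Fin n → ℝ, ∃ (T : ℕ) (u : ℕ → Fin n), IsEquilibrium W (traj W u x T))
    (x0 : Fin n → ℝ) (μ : Measure (ℕ → Fin n)) (hμ : IIDUniform μ) :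
    μ {u | ∃ T : ℕ, IsEquilibrium W (traj W u x0 T) ∧
        ∀ t, T ≤ t → traj W u x0 t = traj W u x0 T} = 1 := by
  have := hμ.1
  have : Nonempty (Fin n) := ⟨⟨0, hn⟩⟩
  obtain ⟨N, v, hv⟩ := exists_uniform_update_sequence H
    (Set.Finite.pi' fun _ : Fin n => Set.finite_range x0)
  refine le_antisymm prob_le_one ?_
  rw [← hμ.measure_limsup_block_eq_one N v]
  refine measure_mono fun u hu => ?_
  rw [Filter.mem_limsup_iff_frequently_mem] at hu
  obtain ⟨k, hk⟩ := hu.exists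
  have heq : IsEquilibrium W (traj W u x0 (k * N + N)) := by
    rw [traj_add, traj_congr _ hk]
    exact hv _ fun i => traj_mem_range u x0 _ i
  refine ⟨k * N + N, heq, fun t ht => ?_⟩
  obtain ⟨s, rfl⟩ := Nat.exists_eq_add_of_le ht
  rw [traj_add, heq.traj_eq]
end

section
/- Given an influence network G(W) on node set V, suppose G(W) has a nonempty maximal cohesive set M with M ≠ V. Define X₀ = {x ∈ ℝ^n : max_{j∈M} x_j < min_{k∈V∖M} x_k, or min_{j∈M} x_j > max_{k∈V∖M} x_k}. Then X₀ has positive Lebesgue measure in ℝ^n, and for every x(0) ∈ X₀ and every update sequence, the trajectory x(t) of the weighted-median opinion dynamics satisfies, for all t ∈ ℕ, that the opinions of the nodes in M remain strictly separated from the opinions of the nodes in V∖M (strictly below if max_{j∈M} x_j(0) < min_{k∈V∖M} x_k(0), strictly above if min_{j∈M} x_j(0) > max_{k∈V∖M} x_k(0)); in particular, x(t) is never a consensus vector. -/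
open Finset MeasureTheory

section WeightedMedian

variable {V : Type*} [Fintype V]

theorem IsWMedian.neg {x w : V → ℝ} {m : ℝ} (h : IsWMedian x w m) :
    IsWMedian (fun i => -x i) w (-m) := by
  obtain ⟨⟨i, hi⟩, hlt, hgt⟩ := h
  refine ⟨⟨i, congrArg Neg.neg hi⟩, ?_, ?_⟩
  · simpa only [neg_lt_neg_iff] using hgt
  · simpa only [neg_lt_neg_iff] using hlt

/-- If the nodes of `S` carry at least half of the total weight and lie strictly below all other
nodes, then the weighted median closest to the opinion of a node of `S` is attained in `S`. -/
theorem IsWMedian.exists_mem_eq_of_lt {x w : V → ℝ} (hw : ∀ j, 0 ≤ w j) (hw1 : ∑ j, w j = 1)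
    {S : Finset V} (hS : 1 / 2 ≤ ∑ j ∈ S, w j) (hx : ∀ j ∈ S, ∀ k ∉ S, x j < x k)
    {i : V} (hi : i ∈ S) {m : ℝ} (hm : IsWMedian x w m)
    (hclosest : ∀ m', IsWMedian x w m' → |m - x i| ≤ |m' - x i|) :
    ∃ k ∈ S, m = x k := by
  classical
  obtain ⟨⟨k, rfl⟩, hlt, -⟩ := hm
  by_contra! hne
  have hk : k ∉ S := fun hk => hne k hk rfl
  obtain ⟨l, hl, hmax⟩ := S.exists_max_image x ⟨i, hi⟩
  have hsum : ∑ j ∈ S, w j ≤ 1 / 2 := by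
    refine le_trans (Finset.sum_le_sum_of_subset_of_nonneg ?_ fun j _ _ => hw j) hlt
    intro j hj
    simpa using hx j hj k hk
  have hcompl : ∑ j ∈ Sᶜ, w j ≤ 1 / 2 := by
    have := Finset.sum_add_sum_compl S w
    linarith
  have hmed : IsWMedian x w (x l) := by
    refine ⟨⟨l, rfl⟩, le_trans (Finset.sum_le_sum_of_subset_of_nonneg ?_ fun j _ _ => hw j) hsum,
      le_trans (Finset.sum_le_sum_of_subset_of_nonneg ?_ fun j _ _ => hw j) hcompl⟩
    · intro j hj
      by_contra hjS
      exact lt_asymm (hx l hl j hjS) (by simpa using hj)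
    · intro j hj
      rw [Finset.mem_compl]
      intro hjS
      exact absurd (hmax j hjS) (not_le.mpr (by simpa using hj))
  have hle := hclosest _ hmed
  have hil := hmax i hi
  have hlk := hx l hl k hk
  rw [abs_of_nonneg (by linarith), abs_of_nonneg (by linarith)] at hle
  linarith

theorem IsWMedian.exists_mem_eq_of_gt {x w : V → ℝ} (hw : ∀ j, 0 ≤ w j) (hw1 : ∑ j, w j = 1)
    {S : Finset V} (hS : 1 / 2 ≤ ∑ j ∈ S, w j) (hx : ∀ j ∈ S, ∀ k ∉ S, x k < x j)
    {i : V} (hi : i ∈ S) {m : ℝ} (hm : IsWMedian x w m)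
    (hclosest : ∀ m', IsWMedian x w m' → |m - x i| ≤ |m' - x i|) :
    ∃ k ∈ S, m = x k := by
  obtain ⟨k, hk, hmk⟩ := IsWMedian.exists_mem_eq_of_lt hw hw1 hS
    (fun j hj k hk => neg_lt_neg (hx j hj k hk)) hi hm.neg fun m' hm' => by
      have h := hclosest (-m') (by simpa using hm'.neg)
      rw [← abs_neg, ← abs_neg (m' - -x i)]
      convert h using 2 <;> ring
  exact ⟨k, hk, neg_injective hmk⟩

/-- A node of a cohesive set that is strictly separated from its complement updates to an opinion
held in that set. -/
theorem exists_mem_Med_eq {W : V → V → ℝ} (hW : RowStochastic W) {S : Finset V}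
    (hS : Cohesive W S) {x : V → ℝ}
    (hx : (∀ j ∈ S, ∀ k ∉ S, x j < x k) ∨ ∀ j ∈ S, ∀ k ∉ S, x k < x j) {i : V} (hi : i ∈ S) :
    ∃ k ∈ S, Med W x i = x k := by
  unfold Med
  split_ifs with h
  · obtain ⟨hm, hclosest⟩ := h.choose_spec
    rcases hx with hx | hx
    · exact hm.exists_mem_eq_of_lt (hW.1 i) (hW.2 i) (hS i hi) hx hi hclosest
    · exact hm.exists_mem_eq_of_gt (hW.1 i) (hW.2 i) (hS i hi) hx hi hclosest
  · exact ⟨i, hi, rfl⟩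

variable [DecidableEq V]

theorem MaxCohesive.cohesive_compl {W : V → V → ℝ} (hW : RowStochastic W) {M : Finset V}
    (hM : MaxCohesive W M) : Cohesive W Mᶜ := by
  intro i hi
  have hle := not_lt.mp (hM.2 i (Finset.mem_compl.mp hi))
  have hsum := Finset.sum_add_sum_compl M (W i)
  rw [hW.2 i] at hsum
  linarith

theorem traj_lt_traj_of_cohesive {W : V → V → ℝ} (hW : RowStochastic W) {S : Finset V}
    (hS : Cohesive W S) (hSc : Cohesive W Sᶜ) {x0 : V → ℝ}
    (hx0 : ∀ j ∈ S, ∀ k ∉ S, x0 j < x0 k) (u : ℕ → V) (t : ℕ) :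
    ∀ j ∈ S, ∀ k ∉ S, traj W u x0 t j < traj W u x0 t k := by
  induction t with
  | zero => exact hx0
  | succ t ih =>
    intro j hj k hk
    have hjk : j ≠ k := fun h => hk (h ▸ hj)
    simp only [traj]
    by_cases hju : j = u t
    · subst hju
      obtain ⟨l, hl, hmed⟩ := exists_mem_Med_eq hW hS (Or.inl ih) hj
      rw [Function.update_self, Function.update_of_ne hjk.symm, hmed]
      exact ih l hl k hk
    · rw [Function.update_of_ne hju]
      by_cases hku : k = u t
      · subst hku
        obtain ⟨l, hl, hmed⟩ := exists_mem_Med_eq hW hSc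
          (Or.inr fun a ha b hb => ih b (by simpa using hb) a (by simpa using ha))
          (Finset.mem_compl.mpr hk)
        rw [Function.update_self, hmed]
        exact ih j hj l (Finset.mem_compl.mp hl)
      · rw [Function.update_of_ne hku]
        exact ih j hj k hk

theorem volume_setOf_forall_lt_pos (S : Finset V) :
    0 < volume {x : V → ℝ | ∀ j ∈ S, ∀ k ∉ S, x j < x k} := by
  refine IsOpen.measure_pos volume ?_ ⟨fun i => if i ∈ S then 0 else 1, ?_⟩
  · simp only [Set.ofPred_forall]
    exact isOpen_iInter_of_finite fun j => isOpen_iInter_of_finite fun _ =>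
      isOpen_iInter_of_finite fun k => isOpen_iInter_of_finite fun _ =>
        isOpen_lt (continuous_apply j) (continuous_apply k)
  · intro j hj k hk
    simp [hj, hk]

end WeightedMedian

/-- if `M` is a nonempty maximal cohesive set with `M ≠ V`, then the set `X₀`
of initial states whose opinions in `M` all lie strictly below (or all strictly above) the
opinions outside `M` has positive Lebesgue measure, and from any such initial state, along
any update sequence, the strict separation persists for all time; in particular the
trajectory is never a consensus vector. -/
theorem dissensus_from_nontrivial_max_cohesive_set (n : ℕ) (hn : 0 < n)
    (W : Fin n → Fin n → ℝ) (hW : RowStochastic W)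
    (M : Finset (Fin n)) (hMne : M.Nonempty) (hM : MaxCohesive W M)
    (hMproper : M ≠ Finset.univ) :
    0 < volume {x : Fin n → ℝ |
        (∀ j ∈ M, ∀ k ∉ M, x j < x k) ∨ (∀ j ∈ M, ∀ k ∉ M, x k < x j)} ∧
    ∀ x0 : Fin n → ℝ,
      ((∀ j ∈ M, ∀ k ∉ M, x0 j < x0 k) ∨ (∀ j ∈ M, ∀ k ∉ M, x0 k < x0 j)) →
      ∀ (u : ℕ → Fin n) (t : ℕ),
        ((∀ j ∈ M, ∀ k ∉ M, x0 j < x0 k) →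
          ∀ j ∈ M, ∀ k ∉ M, traj W u x0 t j < traj W u x0 t k) ∧
        ((∀ j ∈ M, ∀ k ∉ M, x0 k < x0 j) →
          ∀ j ∈ M, ∀ k ∉ M, traj W u x0 t k < traj W u x0 t j) ∧
        ¬ (∀ i j, traj W u x0 t i = traj W u x0 t j) := by
  refine ⟨(volume_setOf_forall_lt_pos M).trans_le (measure_mono fun x hx => Or.inl hx), ?_⟩
  intro x0 hx0 u t
  have hMc := hM.cohesive_compl hW
  have hbelow := fun h => traj_lt_traj_of_cohesive hW hM.1 hMc (x0 := x0) h u t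
  have habove : (∀ j ∈ M, ∀ k ∉ M, x0 k < x0 j) →
      ∀ j ∈ M, ∀ k ∉ M, traj W u x0 t k < traj W u x0 t j := fun h j hj k hk =>
    traj_lt_traj_of_cohesive hW hMc (by simpa using hM.1)
      (fun a ha b hb => h b (by simpa using hb) a (by simpa using ha)) u t
      k (by simpa using hk) j (by simpa using hj)
  refine ⟨hbelow, habove, fun hcons => ?_⟩
  obtain ⟨j, hj⟩ := hMne
  obtain ⟨k, hk⟩ : ∃ k, k ∉ M := by
    by_contra! hall
    exact hMproper (Finset.eq_univ_iff_forall.mpr hall)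
  rcases hx0 with h | h
  · exact (hbelow h j hj k hk).ne (hcons j k)
  · exact (habove h j hj k hk).ne (hcons k j)
end
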